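/- The Cauchy identity for Schur polynomials: for each i ≥ 1, the i-th elementary symmetric function of the products (x_a y_b) equals Σ_{|λ| = i} s_λ(x) · s_{λ'}(y), where the sum runs over partitions λ of i and λ' denotes the conjugate (transposed) partition. -/

import Mathlib

open MvPolynomial Finset

/-- The elementary symmetric polynomial with an integer index (zero for negative index). -/
noncomputable def esymmInt (σ : Type*) [Fintype σ] (R : Type*) [CommRing R] (n : ℤ) :
    MvPolynomial σ R :=
  if 0 ≤ n then MvPolynomial.esymm σ R n.toNat else 0

/-- The conjugate (transposed) partition of `P`, as a `0`-indexed sequence: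
`conjSeq P a = λ'_{a+1} = #{parts of P strictly greater than a}`. -/
def conjSeq {i : ℕ} (P : Nat.Partition i) (a : ℕ) : ℕ :=
  (P.parts.filter (fun p => a < p)).card

/-- The partition `P` itself as a `0`-indexed weakly decreasing sequence (the conjugate of
its conjugate): `partSeq P a = λ_{a+1}`. -/
def partSeq {i : ℕ} (P : Nat.Partition i) (a : ℕ) : ℕ :=
  ((Finset.range i).filter (fun j => a < conjSeq P j)).card

/-- The Schur polynomial of the partition whose conjugate is the sequence `f`, given by the
(dual) Jacobi–Trudi determinant `det (e_{f(a) - a + b})_{a,b < ℓ}`.  In particular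
`schurAux σ R (conjSeq P) ℓ` is the Schur polynomial `s_P` for any `ℓ ≥` the number of
parts of the conjugate of `P`, and `schurAux σ R (partSeq P) ℓ` is `s_{P'}`. -/
noncomputable def schurAux (σ : Type*) [Fintype σ] (R : Type*) [CommRing R]
    (f : ℕ → ℕ) (ℓ : ℕ) : MvPolynomial σ R :=
  Matrix.det (Matrix.of fun a b : Fin ℓ => esymmInt σ R ((f a : ℤ) - (a : ℤ) + (b : ℤ)))


theorem laplace_exp {R : Type*} [CommRing R] {K L : ℕ}
    (M : Matrix (Fin (K + L)) (Fin (K + L)) R) (e : {S : Finset (Fin (K + L)) // #S = K} → (Fin K ⊕ Fin L ≃ Fin (K + L)))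
    (he : ∀ S a, e S (Sum.inl a) ∈ S.1) :
    M.det = ∑ S : {S : Finset (Fin (K + L)) // #S = K},
      ((Equiv.Perm.sign (finSumFinEquiv.symm.trans (e S)) : ℤ) : R) *
        (Matrix.det (Matrix.of fun a b : Fin K => M (e S (Sum.inl a)) (Fin.castAdd L b)) *
         Matrix.det (Matrix.of fun a b : Fin L => M (e S (Sum.inr a)) (Fin.natAdd K b))) := by
  classical
  have himg : ∀ S, univ.image (fun a => e S (Sum.inl a)) = S.1 := by
    intro S
    apply Finset.eq_of_subset_of_card_le
    · intro x hx
      simp only [mem_image, mem_univ, true_and] at hx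
      obtain ⟨a, rfl⟩ := hx
      exact he S a
    · rw [Finset.card_image_of_injective _ (fun a b h => by simpa using h), S.2]; simp
  let φ : ({S : Finset (Fin (K + L)) // #S = K}) × Equiv.Perm (Fin K) × Equiv.Perm (Fin L) →
      Equiv.Perm (Fin (K + L)) := fun q =>
    finSumFinEquiv.symm.trans ((Equiv.Perm.sumCongrHom _ _ q.2).trans (e q.1))
  have hφi : Function.Injective φ := by
    rintro ⟨S, p⟩ ⟨S', p'⟩ h
    have h1 : (Equiv.Perm.sumCongrHom _ _ p).trans (e S) = (Equiv.Perm.sumCongrHom _ _ p').trans (e S') := by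
      ext x
      have := congrArg (fun f => f (finSumFinEquiv x)) h
      simp only [φ, Equiv.trans_apply, Equiv.symm_apply_apply] at this
      simp only [Equiv.trans_apply, this]
    have hS : S = S' := by
      apply Subtype.ext
      rw [← himg S, ← himg S']
      ext x
      simp only [mem_image, mem_univ, true_and]
      constructor
      · rintro ⟨a, rfl⟩
        have := congrArg (fun f => f (Sum.inl (p.1.symm a))) h1
        simp [Equiv.Perm.sumCongrHom] at this
        exact ⟨_, this.symm⟩
      · rintro ⟨a, rfl⟩
        have := congrArg (fun f => f (Sum.inl (p'.1.symm a))) h1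
        simp [Equiv.Perm.sumCongrHom] at this
        exact ⟨_, this⟩
    subst hS
    have h2 : Equiv.Perm.sumCongrHom _ _ p = Equiv.Perm.sumCongrHom _ _ p' := by
      ext x
      have := congrArg (fun f => f x) h1
      simpa using this
    rw [Equiv.Perm.sumCongrHom_injective h2]
  have hφs : Function.Surjective φ := by
    intro σ
    let S : {S : Finset (Fin (K + L)) // #S = K} :=
      ⟨univ.image (fun a : Fin K => σ (Fin.castAdd L a)), by
        rw [Finset.card_image_of_injective _ (fun a b h => by simpa using h)]; simp⟩
    let ρ : Equiv.Perm (Fin K ⊕ Fin L) := finSumFinEquiv.trans (σ.trans (e S).symm)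
    have hρ : Set.MapsTo ρ (Set.range Sum.inl) (Set.range Sum.inl) := by
      rintro _ ⟨a, rfl⟩
      have : σ (Fin.castAdd L a) ∈ S.1 := by
        simp [S]
      rw [← himg S] at this
      simp only [mem_image, mem_univ, true_and] at this
      obtain ⟨b, hb⟩ := this
      refine ⟨b, ?_⟩
      simp [ρ, ← hb]
    obtain ⟨p, hp⟩ := Equiv.Perm.mem_sumCongrHom_range_of_perm_mapsTo_inl hρ
    refine ⟨(S, p), ?_⟩
    ext x
    simp only [φ, hp]
    simp [ρ]
  rw [Matrix.det_apply', ← Function.Bijective.sum_comp ⟨hφi, hφs⟩, Fintype.sum_prod_type]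
  refine Finset.sum_congr rfl fun S _ => ?_
  rw [Fintype.sum_prod_type]
  rw [Matrix.det_apply', Matrix.det_apply', Finset.sum_mul_sum, Finset.mul_sum]
  refine Finset.sum_congr rfl fun π₁ _ => ?_
  rw [Finset.mul_sum]
  refine Finset.sum_congr rfl fun π₂ _ => ?_
  have hs : Equiv.Perm.sign (φ (S, π₁, π₂)) = Equiv.Perm.sign (finSumFinEquiv.symm.trans (e S)) *
      (Equiv.Perm.sign π₁ * Equiv.Perm.sign π₂) := by
    have : φ (S, π₁, π₂) = (finSumFinEquiv.symm.trans (e S)) *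
        (finSumFinEquiv.permCongr (Equiv.Perm.sumCongr π₁ π₂)) := by
      ext x; simp [φ, Equiv.Perm.sumCongrHom]
    rw [this, Equiv.Perm.sign_mul, Equiv.Perm.sign_permCongr, Equiv.Perm.sign_sumCongr]
  rw [hs, ← finSumFinEquiv.prod_comp, Fintype.prod_sum_type]
  simp [φ, Equiv.Perm.sumCongrHom]
  ring

theorem sign_shuffle {K L : ℕ} (e : Fin K ⊕ Fin L ≃ Fin (K + L))
    (h1 : StrictMono fun a => e (Sum.inl a)) (h2 : StrictMono fun a => e (Sum.inr a)) :
    Equiv.Perm.sign (finSumFinEquiv.symm.trans e) =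
      ∏ a, ∏ b, if e (Sum.inl a) < e (Sum.inr b) then 1 else -1 := by
  classical
  rw [Equiv.Perm.sign_eq_prod_prod_Ioi]
  rw [← finSumFinEquiv.prod_comp, Fintype.prod_sum_type]
  have key : ∀ x : Fin K ⊕ Fin L, (∏ j ∈ Ioi (finSumFinEquiv x),
      if (finSumFinEquiv.symm.trans e) (finSumFinEquiv x) < (finSumFinEquiv.symm.trans e) j then
        (1 : ℤˣ) else -1) =
      ∏ z : Fin K ⊕ Fin L, if finSumFinEquiv x < finSumFinEquiv z then
        (if e x < e z then 1 else -1) else 1 := by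
    intro x
    rw [← Finset.filter_lt_eq_Ioi, Finset.prod_filter, ← finSumFinEquiv.prod_comp]
    simp
  simp only [key, Fintype.prod_sum_type]
  have hl : ∀ a b : Fin K, (if (finSumFinEquiv (Sum.inl a) : Fin (K + L)) < finSumFinEquiv (Sum.inl b)
      then (if e (Sum.inl a) < e (Sum.inl b) then (1 : ℤˣ) else -1) else 1) = 1 := by
    intro a b
    split_ifs with h3 h4
    · rfl
    · exact absurd (h1 (by rw [Fin.lt_def] at h3; simpa using h3)) h4
    · rfl
  have hr : ∀ a b : Fin L, (if (finSumFinEquiv (Sum.inr a) : Fin (K + L)) < finSumFinEquiv (Sum.inr b)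
      then (if e (Sum.inr a) < e (Sum.inr b) then (1 : ℤˣ) else -1) else 1) = 1 := by
    intro a b
    split_ifs with h3 h4
    · rfl
    · exact absurd (h2 (by rw [Fin.lt_def] at h3; simpa using h3)) h4
    · rfl
  have hlr : ∀ (a : Fin K) (b : Fin L),
      (finSumFinEquiv (Sum.inl a) : Fin (K + L)) < finSumFinEquiv (Sum.inr b) := by
    intro a b
    simp [Fin.lt_def]; omega
  simp only [hl, hr, hlr, (hlr _ _).not_gt, if_true, if_false, Finset.prod_const_one, one_mul,
    mul_one]

theorem coeff_prod_one_add {ι R : Type*} [CommRing R] (s : Finset ι) (c : ι → R) (k : ℕ) :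
    (∏ a ∈ s, (1 + Polynomial.C (c a) * Polynomial.X)).coeff k =
      ∑ t ∈ s.powersetCard k, ∏ a ∈ t, c a := by
  classical
  rw [Finset.prod_one_add, Polynomial.finsetSum_coeff, Finset.powersetCard_eq_filter,
    Finset.sum_filter]
  refine Finset.sum_congr rfl fun t _ => ?_
  rw [Finset.prod_mul_distrib, Finset.prod_const, ← map_prod, Polynomial.coeff_C_mul,
    Polynomial.coeff_X_pow]
  simp [eq_comm]

theorem natDegree_prod_one_add {ι R : Type*} [CommRing R] (s : Finset ι) (c : ι → R) :
    (∏ a ∈ s, (1 + Polynomial.C (c a) * Polynomial.X)).natDegree ≤ #s := by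
  rw [Polynomial.natDegree_le_iff_coeff_eq_zero]
  intro N hN
  rw [coeff_prod_one_add, Finset.powersetCard_eq_empty.2 hN, Finset.sum_empty]

theorem esymmInt_natCast (n k : ℕ) :
    esymmInt (Fin n) ℤ (k : ℤ) = MvPolynomial.esymm (Fin n) ℤ k := by
  simp [esymmInt]

theorem esymmInt_neg (n : ℕ) (k : ℤ) (hk : k < 0) : esymmInt (Fin n) ℤ k = 0 := by
  simp [esymmInt, hk]

theorem esymmInt_large (n : ℕ) (k : ℤ) (hk : (n : ℤ) < k) : esymmInt (Fin n) ℤ k = 0 := by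
  rw [esymmInt, if_pos (by omega), MvPolynomial.esymm, Finset.powersetCard_eq_empty.2,
    Finset.sum_empty]
  simp; omega

theorem rename_esymm_fin {τ : Type*} (n k : ℕ) (g : Fin n → τ) :
    rename g (MvPolynomial.esymm (Fin n) ℤ k) =
      ∑ t ∈ (univ : Finset (Fin n)).powersetCard k, ∏ a ∈ t, X (g a) := by
  simp [MvPolynomial.esymm, map_sum, map_prod]

theorem coeff_G {R : Type*} [CommRing R] (m K : ℕ) (hK : m ≤ K) (y : Fin m → R) (k : ℕ)
    (hk : k ≤ K) :
    (Polynomial.X ^ (K - m) * ∏ j, (Polynomial.X - Polynomial.C (y j))).coeff (K - k) =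
      (-1) ^ k * ∑ t ∈ (univ : Finset (Fin m)).powersetCard k, ∏ a ∈ t, y a := by
  rw [Polynomial.coeff_X_pow_mul']
  split_ifs with h
  · have := Finset.prod_X_add_C_coeff (univ : Finset (Fin m)) (fun j => - y j)
      (k := K - k - (K - m)) (by simp; omega)
    simp only [map_neg, ← sub_eq_add_neg] at this
    rw [this]
    have h2 : #(univ : Finset (Fin m)) - (K - k - (K - m)) = k := by simp; omega
    rw [h2, Finset.mul_sum]
    refine Finset.sum_congr rfl fun t ht => ?_
    rw [Finset.prod_neg, (Finset.mem_powersetCard.1 ht).2]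
  · rw [Finset.powersetCard_eq_empty.2 (by simp; omega)]; simp

theorem monic_G {R : Type*} [CommRing R] [IsDomain R] (m K : ℕ) (hK : m ≤ K) (y : Fin m → R) :
    (Polynomial.X ^ (K - m) * ∏ j, (Polynomial.X - Polynomial.C (y j))).Monic ∧
    (Polynomial.X ^ (K - m) * ∏ j, (Polynomial.X - Polynomial.C (y j))).natDegree = K := by
  have h1 : (∏ j, (Polynomial.X - Polynomial.C (y j))).Monic :=
    Polynomial.monic_prod_of_monic _ _ fun j _ => Polynomial.monic_X_sub_C _
  refine ⟨(Polynomial.monic_X_pow _).mul h1, ?_⟩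
  rw [(Polynomial.monic_X_pow _).natDegree_mul h1, Polynomial.natDegree_X_pow,
    Polynomial.natDegree_prod_of_monic _ _ fun j _ => Polynomial.monic_X_sub_C _]
  simp; omega

theorem resultant_GF {R : Type*} [CommRing R] [IsDomain R] (m n K : ℕ) (hK : m ≤ K) (hn : n ≤ K)
    (y : Fin m → R) (x : Fin n → R) :
    (Polynomial.resultant (Polynomial.X ^ (K - m) * ∏ j, (Polynomial.X - Polynomial.C (y j)))
      (∏ a, (1 + Polynomial.C (x a) * Polynomial.X)) K K) =
      ∏ p : Fin n × Fin m, (1 + x p.1 * y p.2) := by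
  have h := Polynomial.resultant_eq_prod_eval
    (Polynomial.X ^ (K - m) * ∏ j, (Polynomial.X - Polynomial.C (y j)))
    (∏ a, (1 + Polynomial.C (x a) * Polynomial.X)) K
    ((natDegree_prod_one_add _ _).trans (by simpa using hn))
    ((Polynomial.Splits.X_pow _).mul (Polynomial.Splits.prod fun j _ => Polynomial.Splits.X_sub_C _))
  rw [(monic_G m K hK y).2, (monic_G m K hK y).1.leadingCoeff] at h
  have hr : (∏ j, (Polynomial.X - Polynomial.C (y j))).roots = univ.val.map y := by
    have := Polynomial.roots_multiset_prod_X_sub_C (univ.val.map y)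
    rwa [Multiset.map_map] at this
  rw [h, Polynomial.roots_mul (monic_G m K hK y).1.ne_zero, Polynomial.roots_X_pow,
    hr, Fintype.prod_prod_type_right]
  rw [Multiset.map_add, Multiset.prod_add, Multiset.map_map, Multiset.map_nsmul,
    Multiset.prod_nsmul]
  have h1 : ∏ j, Polynomial.eval (y j) (∏ a, (1 + Polynomial.C (x a) * Polynomial.X)) =
      ∏ j, ∏ a, (1 + x a * y j) := by
    simp [Polynomial.eval_prod]
  rw [← h1]
  simp only [one_pow, one_mul, Multiset.map_singleton, Multiset.prod_singleton]
  simp only [Polynomial.eval_prod, Polynomial.eval_add, Polynomial.eval_one, Polynomial.eval_mul,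
    Polynomial.eval_C, Polynomial.eval_X, mul_zero, add_zero, Finset.prod_const_one, one_pow,
    one_mul]
  rfl

theorem schurAux_succ (n : ℕ) (f : ℕ → ℕ) (l : ℕ) (h : f l = 0) :
    schurAux (Fin n) ℤ f (l + 1) = schurAux (Fin n) ℤ f l := by
  rw [schurAux, Matrix.det_succ_row _ (Fin.last l), Finset.sum_eq_single (Fin.last l)]
  · simp only [Matrix.of_apply, Fin.val_last, h, schurAux]
    have : esymmInt (Fin n) ℤ (((0 : ℕ) : ℤ) - l + l) = 1 := by
      have := esymmInt_natCast n 0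
      simpa using this
    rw [this, mul_one, ← two_mul, pow_mul]
    simp only [neg_one_sq, one_pow, one_mul]
    congr 1
    ext a b : 2
    simp [Fin.succAbove_last]
  · intro b _ hb
    rw [Matrix.of_apply, esymmInt_neg]
    · simp
    · have := Fin.val_lt_last hb
      simp [h]; omega
  · simp

theorem schurAux_add (n : ℕ) (f : ℕ → ℕ) (l r : ℕ) (h : ∀ a, l ≤ a → f a = 0) :
    schurAux (Fin n) ℤ f (l + r) = schurAux (Fin n) ℤ f l := by
  induction r with
  | zero => rfl
  | succ r ih => rw [← add_assoc, schurAux_succ _ _ _ (h _ (by omega)), ih]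

theorem conjSeq_anti {i : ℕ} (P : Nat.Partition i) : Antitone (conjSeq P) := by
  intro a b h
  exact Multiset.card_le_card (Multiset.monotone_filter_right _ fun p hp => by omega)

theorem conjSeq_zero {i : ℕ} (P : Nat.Partition i) (a : ℕ) (h : i ≤ a) : conjSeq P a = 0 := by
  rw [conjSeq, Multiset.card_eq_zero, Multiset.filter_eq_nil]
  intro p hp
  have := P.parts_sum ▸ Multiset.single_le_sum (fun _ _ => Nat.zero_le _) p hp
  omega

theorem count_lt (p K : ℕ) (h : p ≤ K) : ∑ a ∈ range K, (if a < p then 1 else 0) = p := by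
  rw [← Finset.card_filter]
  have : (range K).filter (fun a => a < p) = range p := by
    ext a; simp; omega
  rw [this, card_range]

theorem multiset_sum_count (s : Multiset ℕ) (K : ℕ) (h : ∀ p ∈ s, p ≤ K) :
    ∑ a ∈ range K, (s.filter (fun p => a < p)).card = s.sum := by
  induction s using Multiset.induction_on with
  | empty => simp
  | cons p s ih =>
    have h1 := ih fun q hq => h q (Multiset.mem_cons_of_mem hq)
    have h2 := count_lt p K (h p (Multiset.mem_cons_self p s))
    rw [Multiset.sum_cons, ← h1, ← h2, h2, ← h2, ← Finset.sum_add_distrib, h2]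
    refine Finset.sum_congr rfl fun a _ => ?_
    rw [Multiset.filter_cons]
    split_ifs <;> simp [add_comm]

theorem conjSeq_sum {i : ℕ} (P : Nat.Partition i) (K : ℕ) (h : i ≤ K) :
    ∑ a ∈ range K, conjSeq P a = i := by
  have := multiset_sum_count P.parts K fun p hp => by
    have := P.parts_sum ▸ Multiset.single_le_sum (fun _ _ => Nat.zero_le _) p hp
    omega
  rw [P.parts_sum] at this
  exact this

theorem conjSeq_le {i : ℕ} (P : Nat.Partition i) (a : ℕ) : conjSeq P a ≤ i := by
  have h := conjSeq_sum P (i + a + 1) (by omega)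
  have := Finset.single_le_sum (f := conjSeq P) (fun _ _ => Nat.zero_le _)
    (show a ∈ range (i + a + 1) by rw [mem_range]; omega)
  omega

/-- An initial-segment count. -/
theorem lt_count_iff (f : ℕ → ℕ) (hf : Antitone f) (N a b : ℕ) :
    a < #((range N).filter (fun j => b < f j)) ↔ a < N ∧ b < f a := by
  constructor
  · intro h
    by_contra hc
    have : (range N).filter (fun j => b < f j) ⊆ range a := by
      intro j hj
      simp only [mem_filter, mem_range] at hj ⊢
      by_contra hja
      have := hf (not_lt.1 hja)
      omega
    have := card_le_card this
    simp at this
    omega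
  · rintro ⟨h1, h2⟩
    have : range (a + 1) ⊆ (range N).filter (fun j => b < f j) := by
      intro j hj
      simp only [mem_filter, mem_range] at hj ⊢
      have := hf (show j ≤ a by omega)
      omega
    have := card_le_card this
    simp at this
    omega

theorem lt_partSeq_iff {i : ℕ} (P : Nat.Partition i) (a b : ℕ) :
    a < partSeq P b ↔ b < conjSeq P a := by
  rw [partSeq, lt_count_iff _ (conjSeq_anti P)]
  constructor
  · exact fun h => h.2
  · intro h
    refine ⟨?_, h⟩
    by_contra hc
    rw [conjSeq_zero P a (by omega)] at h
    omega

theorem partSeq_anti {i : ℕ} (P : Nat.Partition i) : Antitone (partSeq P) := by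
  intro a b h
  exact card_le_card (fun j => by simp; omega)

theorem partSeq_zero {i : ℕ} (P : Nat.Partition i) (a : ℕ) (h : i ≤ a) : partSeq P a = 0 := by
  by_contra hc
  have := (lt_partSeq_iff P 0 a).1 (by omega)
  have := conjSeq_le P 0
  omega

theorem partSeq_le {i : ℕ} (P : Nat.Partition i) (a : ℕ) : partSeq P a ≤ i := by
  exact (card_le_card (filter_subset _ _)).trans (by simp)

theorem partSeq_sum {i : ℕ} (P : Nat.Partition i) (K : ℕ) (h : i ≤ K) :
    ∑ a ∈ range K, partSeq P a = i := by
  simp only [partSeq, card_filter]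
  rw [Finset.sum_comm]
  have : ∀ j ∈ range i, ∑ a ∈ range K, (if a < conjSeq P j then 1 else 0) = conjSeq P j :=
    fun j _ => count_lt _ _ ((conjSeq_le P j).trans h)
  rw [Finset.sum_congr rfl this, conjSeq_sum P i le_rfl]

theorem conjSeq_injective {i : ℕ} (P Q : Nat.Partition i) (h : ∀ a, conjSeq P a = conjSeq Q a) :
    P = Q := by
  have key : ∀ (R : Nat.Partition i) (k : ℕ), 0 < k →
      R.parts.count k = conjSeq R (k - 1) - conjSeq R k := by
    intro R k hk
    have h1 : R.parts.filter (fun p => k - 1 < p) =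
        R.parts.filter (fun p => k = p) + R.parts.filter (fun p => k < p) := by
      rw [Multiset.filter_add_filter]
      rw [show R.parts.filter (fun a => k = a ∧ k < a) = 0 from
        Multiset.filter_eq_nil.2 (by intro a _; omega), add_zero]
      apply Multiset.filter_congr
      intro a _
      omega
    have h2 := congrArg Multiset.card h1
    rw [Multiset.card_add] at h2
    rw [conjSeq, conjSeq, h2, Multiset.count_eq_card_filter_eq]
    omega
  apply Nat.Partition.ext
  ext k
  rcases Nat.eq_zero_or_pos k with rfl | hk
  · rw [Multiset.count_eq_zero_of_notMem, Multiset.count_eq_zero_of_notMem]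
    · intro h0; exact absurd (Q.parts_pos h0) (lt_irrefl _)
    · intro h0; exact absurd (P.parts_pos h0) (lt_irrefl _)
  · rw [key P k hk, key Q k hk, h, h]

theorem conjSeq_surj (i K : ℕ) (f : ℕ → ℕ) (hf : Antitone f) (h0 : ∀ a, K ≤ a → f a = 0)
    (hs : ∑ a ∈ range K, f a = i) : ∃ P : Nat.Partition i, ∀ a, conjSeq P a = f a := by
  have hle : ∀ a, f a ≤ i := by
    intro a
    by_cases ha : a < K
    · rw [← hs]
      exact Finset.single_le_sum (f := f) (fun _ _ => Nat.zero_le _) (by simpa using ha)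
    · rw [h0 a (by omega)]; omega
  let s : Multiset ℕ := (range i).val.map fun b => #((range K).filter (fun j => b < f j))
  have hsum : s.sum = i := by
    change ∑ b ∈ range i, #((range K).filter (fun j => b < f j)) = i
    simp only [card_filter]
    rw [Finset.sum_comm, Finset.sum_congr rfl (fun j _ => count_lt _ _ (hle j)), hs]
  refine ⟨Nat.Partition.ofSums i s hsum, fun a => ?_⟩
  simp only [conjSeq, Nat.Partition.ofSums]
  rw [Multiset.filter_filter, Multiset.filter_congr (q := fun p => a < p) (by intro x _; omega)]
  rw [Multiset.filter_map, Multiset.card_map]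
  change #((range i).filter _) = f a
  have : (range i).filter ((fun p => a < p) ∘ fun b => #((range K).filter (fun j => b < f j)))
      = range (f a) := by
    ext b
    simp only [mem_filter, mem_range, Function.comp, lt_count_iff f hf]
    have := hle a
    constructor
    · rintro ⟨_, _, h⟩; exact h
    · intro h
      refine ⟨by omega, ?_, h⟩
      by_contra hc
      rw [h0 a (by omega)] at h
      omega
  rw [this, card_range]

theorem neg_one_pow_aux {R : Type*} [CommRing R] (c a b : ℕ) (h : c = a + 2 * b) :
    (-1 : R) ^ c = (-1) ^ a := by
  rw [h, pow_add, pow_mul, neg_one_sq, one_pow, mul_one]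

theorem sylv_left (n m K : ℕ) (hn : n ≤ K) (G : Polynomial (Polynomial (MvPolynomial (Fin n ⊕ Fin m) ℤ)))
    (p : Fin (K + K)) (j : Fin K) :
    Polynomial.X ^ (j : ℕ) * Polynomial.sylvester G
      (∏ a : Fin n, (1 + Polynomial.C (Polynomial.X * Polynomial.C (X (Sum.inl a))) * Polynomial.X))
      K K p (Fin.castAdd K j) =
    Polynomial.X ^ (p : ℕ) *
      Polynomial.C (rename Sum.inl (esymmInt (Fin n) ℤ ((p : ℤ) - (j : ℤ)))) := by
  simp only [Polynomial.sylvester, Matrix.of_apply, Fin.addCases_left, Set.mem_Icc]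
  split_ifs with h
  · rw [coeff_prod_one_add, show (p : ℤ) - (j : ℤ) = ((p - j : ℕ) : ℤ) by omega, esymmInt_natCast,
      rename_esymm_fin]
    have h1 : ∀ t ∈ powersetCard ((p : ℕ) - j) (univ : Finset (Fin n)),
        ∏ a ∈ t, (Polynomial.X * Polynomial.C (X (Sum.inl a)) :
          Polynomial (MvPolynomial (Fin n ⊕ Fin m) ℤ)) =
        Polynomial.X ^ ((p : ℕ) - j) * Polynomial.C (∏ a ∈ t, X (Sum.inl a)) := by
      intro t ht
      rw [Finset.prod_mul_distrib, Finset.prod_const, (mem_powersetCard.1 ht).2, map_prod]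
    rw [Finset.sum_congr rfl h1, ← Finset.mul_sum, ← mul_assoc, ← pow_add, ← map_sum]
    congr 2
    omega
  · rcases lt_or_ge (p : ℕ) j with h1 | h1
    · rw [esymmInt_neg _ _ (by omega)]; simp
    · rw [esymmInt_large _ _ (by omega)]; simp

theorem sylv_right (n m K : ℕ) (hm : m ≤ K) (F : Polynomial (Polynomial (MvPolynomial (Fin n ⊕ Fin m) ℤ)))
    (p : Fin (K + K)) (j : Fin K) :
    Polynomial.sylvester (Polynomial.X ^ (K - m) *
      ∏ j : Fin m, (Polynomial.X - Polynomial.C (Polynomial.C (X (Sum.inr j))))) F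
      K K p (Fin.natAdd K j) =
    (-1) ^ (K + (p : ℕ)) * ((-1) ^ (j : ℕ) *
      Polynomial.C (rename Sum.inr (esymmInt (Fin m) ℤ ((K : ℤ) - (p : ℤ) + (j : ℤ))))) := by
  simp only [Polynomial.sylvester, Matrix.of_apply, Fin.addCases_right, Set.mem_Icc]
  split_ifs with h
  · rw [show (p : ℕ) - j = K - (K + j - p) by omega, coeff_G m K hm _ _ (by omega),
      show (K : ℤ) - (p : ℤ) + (j : ℤ) = ((K + j - p : ℕ) : ℤ) by omega, esymmInt_natCast,
      rename_esymm_fin, map_sum, ← mul_assoc]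
    congr 1
    · rw [← pow_add]
      exact (neg_one_pow_aux _ _ (p : ℕ) (by omega)).symm
    · simp [map_prod]
  · rcases lt_or_ge (p : ℕ) j with h1 | h1
    · rw [esymmInt_large _ _ (by omega)]; simp
    · rw [esymmInt_neg _ _ (by omega)]; simp

/-- the shuffle equivalence -/
noncomputable def shuf (K : ℕ) (S : {S : Finset (Fin (K + K)) // #S = K}) :
    Fin K ⊕ Fin K ≃ Fin (K + K) :=
  finSumEquivOfFinset S.2 (by rw [card_compl, S.2]; simp)

theorem shuf_inl (K : ℕ) (S : {S : Finset (Fin (K + K)) // #S = K}) (f : Fin K → Fin (K + K))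
    (hf : StrictMono f) (h : ∀ a, f a ∈ S.1) (a : Fin K) : shuf K S (Sum.inl a) = f a := by
  rw [shuf, finSumEquivOfFinset_inl, ← orderEmbOfFin_unique S.2 h hf]

theorem shuf_inr (K : ℕ) (S : {S : Finset (Fin (K + K)) // #S = K}) (f : Fin K → Fin (K + K))
    (hf : StrictMono f) (h : ∀ a, f a ∉ S.1) (a : Fin K) : shuf K S (Sum.inr a) = f a := by
  rw [shuf, finSumEquivOfFinset_inr, ← orderEmbOfFin_unique (s := S.1ᶜ) _ (by simpa using h) hf]

theorem shuf_inl_mem (K : ℕ) (S : {S : Finset (Fin (K + K)) // #S = K}) (a : Fin K) :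
    shuf K S (Sum.inl a) ∈ S.1 := by
  rw [shuf, finSumEquivOfFinset_inl]; exact orderEmbOfFin_mem _ _ _

theorem shuf_inl_mono (K : ℕ) (S : {S : Finset (Fin (K + K)) // #S = K}) :
    StrictMono fun a => shuf K S (Sum.inl a) := by
  intro a b h
  simp only [shuf, finSumEquivOfFinset_inl]
  exact (orderEmbOfFin _ _).strictMono h

theorem shuf_inr_mono (K : ℕ) (S : {S : Finset (Fin (K + K)) // #S = K}) :
    StrictMono fun a => shuf K S (Sum.inr a) := by
  intro a b h
  simp only [shuf, finSumEquivOfFinset_inr]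
  exact (orderEmbOfFin _ _).strictMono h

theorem shuf_image (K : ℕ) (S : {S : Finset (Fin (K + K)) // #S = K}) :
    univ.image (fun a => shuf K S (Sum.inl a)) = S.1 := by
  apply Finset.eq_of_subset_of_card_le
  · intro x hx
    simp only [mem_image, mem_univ, true_and] at hx
    obtain ⟨a, rfl⟩ := hx
    exact shuf_inl_mem K S a
  · rw [Finset.card_image_of_injective _ (fun a b h => by simpa using h), S.2]; simp

/-- weight of a term of the Laplace expansion -/
noncomputable def wt (n m K : ℕ) (S : {S : Finset (Fin (K + K)) // #S = K}) :
    MvPolynomial (Fin n ⊕ Fin m) ℤ :=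
  ((Equiv.Perm.sign (finSumFinEquiv.symm.trans (shuf K S)) : ℤ) : MvPolynomial (Fin n ⊕ Fin m) ℤ) *
    (Matrix.det (Matrix.of fun a b : Fin K => (rename Sum.inl (esymmInt (Fin n) ℤ
        ((shuf K S (Sum.inl a) : ℕ) - (b : ℤ))) : MvPolynomial (Fin n ⊕ Fin m) ℤ)) *
     ((∏ a : Fin K, (-1) ^ (K + (shuf K S (Sum.inr a) : ℕ))) * ((∏ b : Fin K, (-1) ^ (b : ℕ)) *
      Matrix.det (Matrix.of fun a b : Fin K => (rename Sum.inr (esymmInt (Fin m) ℤ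
        ((K : ℤ) - (shuf K S (Sum.inr a) : ℕ) + (b : ℤ))) : MvPolynomial (Fin n ⊕ Fin m) ℤ)))))

theorem expansion (n m K : ℕ) (hn : n ≤ K) (hm : m ≤ K) :
    Polynomial.X ^ (∑ a : Fin K, (a : ℕ)) *
      ∏ p : Fin n × Fin m, (1 + Polynomial.C (X (Sum.inl p.1) * X (Sum.inr p.2) :
        MvPolynomial (Fin n ⊕ Fin m) ℤ) * Polynomial.X) =
    ∑ S : {S : Finset (Fin (K + K)) // #S = K},
      Polynomial.X ^ (∑ a : Fin K, (shuf K S (Sum.inl a) : ℕ)) * Polynomial.C (wt n m K S) := by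
  have h := resultant_GF (R := Polynomial (MvPolynomial (Fin n ⊕ Fin m) ℤ)) m n K hm hn
    (fun j => Polynomial.C (X (Sum.inr j))) (fun a => Polynomial.X * Polynomial.C (X (Sum.inl a)))
  have h2 : ∏ p : Fin n × Fin m, (1 + Polynomial.C (X (Sum.inl p.1) * X (Sum.inr p.2) :
        MvPolynomial (Fin n ⊕ Fin m) ℤ) * Polynomial.X) =
      ∏ p : Fin n × Fin m, (1 + Polynomial.X * Polynomial.C (X (Sum.inl p.1)) *
        Polynomial.C (X (Sum.inr p.2))) := by
    refine Finset.prod_congr rfl fun p _ => ?_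
    rw [map_mul]; ring
  rw [h2, ← h, Polynomial.resultant, laplace_exp _ (shuf K) (shuf_inl_mem K), Finset.mul_sum]
  refine Finset.sum_congr rfl fun S _ => ?_
  simp only [sylv_right n m K hm]
  have hB := Matrix.det_mul_column (fun a : Fin K => (-1 : Polynomial (MvPolynomial (Fin n ⊕ Fin m) ℤ))
      ^ (K + (shuf K S (Sum.inr a) : ℕ)))
    (Matrix.of fun a j : Fin K => ((-1) ^ (j : ℕ) * Polynomial.C (rename Sum.inr (esymmInt (Fin m) ℤ
      ((K : ℤ) - ((shuf K S (Sum.inr a) : ℕ) : ℤ) + (j : ℤ))))))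
  have hB2 := Matrix.det_mul_row (fun j : Fin K => (-1 : Polynomial (MvPolynomial (Fin n ⊕ Fin m) ℤ))
      ^ (j : ℕ))
    (Matrix.of fun a j : Fin K => (Polynomial.C (rename Sum.inr (esymmInt (Fin m) ℤ
      ((K : ℤ) - ((shuf K S (Sum.inr a) : ℕ) : ℤ) + (j : ℤ))) : MvPolynomial (Fin n ⊕ Fin m) ℤ)))
  have hB3 := RingHom.map_det (Polynomial.C : MvPolynomial (Fin n ⊕ Fin m) ℤ →+* _)
    (Matrix.of fun a j : Fin K => (rename Sum.inr (esymmInt (Fin m) ℤ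
      ((K : ℤ) - ((shuf K S (Sum.inr a) : ℕ) : ℤ) + (j : ℤ)))))
  have hA := Matrix.det_mul_row (fun j : Fin K =>
      (Polynomial.X : Polynomial (MvPolynomial (Fin n ⊕ Fin m) ℤ)) ^ (j : ℕ))
    (Matrix.of fun a j : Fin K => Polynomial.sylvester (Polynomial.X ^ (K - m) *
      ∏ j : Fin m, (Polynomial.X - Polynomial.C (Polynomial.C (X (Sum.inr j)))))
      (∏ a : Fin n, (1 + Polynomial.C (Polynomial.X * Polynomial.C (X (Sum.inl a))) * Polynomial.X))
      K K (shuf K S (Sum.inl a)) (Fin.castAdd K j))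
  have hA2 := Matrix.det_mul_column (fun a : Fin K =>
      (Polynomial.X : Polynomial (MvPolynomial (Fin n ⊕ Fin m) ℤ)) ^ (shuf K S (Sum.inl a) : ℕ))
    (Matrix.of fun a j : Fin K => (Polynomial.C (rename Sum.inl (esymmInt (Fin n) ℤ
      (((shuf K S (Sum.inl a) : ℕ) : ℤ) - (j : ℤ))) : MvPolynomial (Fin n ⊕ Fin m) ℤ)))
  have hA3 := RingHom.map_det (Polynomial.C : MvPolynomial (Fin n ⊕ Fin m) ℤ →+* _)
    (Matrix.of fun a j : Fin K => (rename Sum.inl (esymmInt (Fin n) ℤ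
      (((shuf K S (Sum.inl a) : ℕ) : ℤ) - (j : ℤ)))))
  simp only [Matrix.of_apply] at hB hB2 hA hA2
  simp only [sylv_left n m K hn] at hA
  rw [hA2, Finset.prod_pow_eq_pow_sum, Finset.prod_pow_eq_pow_sum] at hA
  rw [hB, hB2, wt, mul_left_comm, ← mul_assoc (Polynomial.X ^ _) (Matrix.det _) _, ← hA]
  simp only [map_mul, hB3, hA3, map_prod, map_pow, map_neg, map_one, map_intCast]
  have e1 : ∀ M : Matrix (Fin K) (Fin K) (MvPolynomial (Fin n ⊕ Fin m) ℤ),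
    (Polynomial.C : MvPolynomial (Fin n ⊕ Fin m) ℤ →+* _).mapMatrix M =
      Matrix.of fun a j => Polynomial.C (M a j) := fun M => rfl
  simp only [e1, Matrix.of_apply]
  ring

theorem lhs_eq (i n m K : ℕ) (hn : n ≤ K) (hm : m ≤ K) :
    (∑ s ∈ (univ : Finset (Fin n × Fin m)).powersetCard i,
        ∏ p ∈ s, (X (Sum.inl p.1) * X (Sum.inr p.2) : MvPolynomial (Fin n ⊕ Fin m) ℤ))
      = ∑ S : {S : Finset (Fin (K + K)) // #S = K} with
          ∑ a : Fin K, (shuf K S (Sum.inl a) : ℕ) = i + ∑ a : Fin K, (a : ℕ), wt n m K S := by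
  have h := congrArg (fun q => Polynomial.coeff q (i + ∑ a : Fin K, (a : ℕ))) (expansion n m K hn hm)
  simp only [Polynomial.coeff_X_pow_mul, coeff_prod_one_add, Polynomial.finsetSum_coeff] at h
  rw [h, Finset.sum_filter]
  refine Finset.sum_congr rfl fun S _ => ?_
  rw [mul_comm, Polynomial.coeff_C_mul, Polynomial.coeff_X_pow]
  simp [eq_comm]

/-- positions of the first block -/
def posL {i : ℕ} (P : Nat.Partition i) (K : ℕ) (h : i ≤ K) (a : Fin K) : Fin (K + K) :=
  ⟨conjSeq P (K - 1 - a) + a, by have := conjSeq_le P (K - 1 - a); omega⟩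

/-- positions of the second block -/
def posR {i : ℕ} (P : Nat.Partition i) (K : ℕ) (b : Fin K) : Fin (K + K) :=
  ⟨K + b - partSeq P b, by omega⟩

theorem posL_mono {i : ℕ} (P : Nat.Partition i) (K : ℕ) (h : i ≤ K) : StrictMono (posL P K h) := by
  intro a b hab
  have h1 := conjSeq_anti P (show K - 1 - (b : ℕ) ≤ K - 1 - a by omega)
  simp only [posL, Fin.lt_def] at hab ⊢
  omega

theorem posR_mono {i : ℕ} (P : Nat.Partition i) (K : ℕ) (h : i ≤ K) : StrictMono (posR P K) := by
  intro a b hab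
  have h1 := partSeq_anti P (show (a : ℕ) ≤ b by omega)
  have h2 := partSeq_le P a
  simp only [posR, Fin.lt_def] at hab ⊢
  omega

theorem posL_lt_posR {i : ℕ} (P : Nat.Partition i) (K : ℕ) (h : i ≤ K) (a b : Fin K) :
    (posL P K h a < posR P K b ↔ ¬ (b : ℕ) < conjSeq P (K - 1 - a)) ∧
      posL P K h a ≠ posR P K b := by
  have h1 := lt_partSeq_iff P (K - 1 - a) b
  have h2 := partSeq_le P b
  simp only [posL, posR, Fin.lt_def, ne_eq, Fin.mk.injEq]
  by_cases h3 : (b : ℕ) < conjSeq P (K - 1 - a)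
  · have h4 := h1.2 h3
    constructor
    · constructor
      · intro h5; omega
      · intro h5; omega
    · omega
  · have h4 : ¬ (K - 1 - (a : ℕ)) < partSeq P b := fun h5 => h3 (h1.1 h5)
    constructor
    · constructor
      · intro h5; omega
      · intro h5; omega
    · omega

/-- the subset attached to a partition -/
def partSet {i : ℕ} (P : Nat.Partition i) (K : ℕ) (h : i ≤ K) :
    {S : Finset (Fin (K + K)) // #S = K} :=
  ⟨univ.image (posL P K h), by
    rw [Finset.card_image_of_injective _ (posL_mono P K h).injective]; simp⟩

theorem shuf_partSet_inl {i : ℕ} (P : Nat.Partition i) (K : ℕ) (h : i ≤ K) (a : Fin K) :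
    shuf K (partSet P K h) (Sum.inl a) = posL P K h a :=
  shuf_inl K _ _ (posL_mono P K h) (fun a => by simp [partSet]) a

theorem shuf_partSet_inr {i : ℕ} (P : Nat.Partition i) (K : ℕ) (h : i ≤ K) (a : Fin K) :
    shuf K (partSet P K h) (Sum.inr a) = posR P K a :=
  shuf_inr K _ _ (posR_mono P K h) (fun b => by
    simp only [partSet, mem_image, mem_univ, true_and, not_exists]
    exact fun a => (posL_lt_posR P K h a b).2) a

theorem sum_rev (K : ℕ) (f : ℕ → ℕ) : ∑ a : Fin K, f (K - 1 - a) = ∑ a ∈ range K, f a := by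
  rw [Fin.sum_univ_eq_sum_range (fun a => f (K - 1 - a)), Finset.sum_range_reflect]

theorem sign_partSet {i : ℕ} (P : Nat.Partition i) (K : ℕ) (h : i ≤ K) :
    Equiv.Perm.sign (finSumFinEquiv.symm.trans (shuf K (partSet P K h))) = (-1) ^ i := by
  rw [sign_shuffle _ (shuf_inl_mono K _) (shuf_inr_mono K _)]
  have h1 : ∀ a : Fin K, (∏ b : Fin K, if shuf K (partSet P K h) (Sum.inl a) <
      shuf K (partSet P K h) (Sum.inr b) then (1 : ℤˣ) else -1) = (-1) ^ (conjSeq P (K - 1 - a)) := by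
    intro a
    simp only [shuf_partSet_inl, shuf_partSet_inr, (posL_lt_posR P K h a _).1, ite_not]
    rw [Fin.prod_univ_eq_prod_range (fun b => if b < conjSeq P (K - 1 - a) then (-1 : ℤˣ) else 1),
      ← Finset.prod_filter, Finset.prod_const, Finset.card_filter,
      count_lt _ _ ((conjSeq_le P _).trans h)]
  rw [Finset.prod_congr rfl fun a _ => h1 a, Finset.prod_pow_eq_pow_sum, sum_rev,
    conjSeq_sum P K h]

theorem wt_partSet {i : ℕ} (P : Nat.Partition i) (n m K : ℕ) (h : i ≤ K) :
    wt n m K (partSet P K h) = rename Sum.inl (schurAux (Fin n) ℤ (conjSeq P) K) *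
      rename Sum.inr (schurAux (Fin m) ℤ (partSeq P) K) := by
  have hX : Matrix.det (Matrix.of fun a b : Fin K => (rename Sum.inl (esymmInt (Fin n) ℤ
        ((shuf K (partSet P K h) (Sum.inl a) : ℕ) - (b : ℤ))) : MvPolynomial (Fin n ⊕ Fin m) ℤ)) =
      rename Sum.inl (schurAux (Fin n) ℤ (conjSeq P) K) := by
    rw [schurAux, AlgHom.map_det, ← Matrix.det_submatrix_equiv_self Fin.revPerm]
    congr 1
    refine Matrix.ext fun a b => ?_
    simp only [Matrix.submatrix_apply, Matrix.of_apply, AlgHom.mapMatrix_apply, Matrix.map_apply,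
      shuf_partSet_inl, posL, Fin.revPerm_apply, Fin.val_rev]
    refine congrArg (fun z : ℤ => rename Sum.inl (esymmInt (Fin n) ℤ z)) ?_
    rw [show K - 1 - (K - ((a : ℕ) + 1)) = a by omega]
    omega
  have hY : Matrix.det (Matrix.of fun a b : Fin K => (rename Sum.inr (esymmInt (Fin m) ℤ
        ((K : ℤ) - (shuf K (partSet P K h) (Sum.inr a) : ℕ) + (b : ℤ))) :
          MvPolynomial (Fin n ⊕ Fin m) ℤ)) =
      rename Sum.inr (schurAux (Fin m) ℤ (partSeq P) K) := by
    rw [schurAux, AlgHom.map_det]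
    congr 1
    refine Matrix.ext fun a b => ?_
    have := partSeq_le P a
    simp only [Matrix.of_apply, AlgHom.mapMatrix_apply, Matrix.map_apply,
      shuf_partSet_inr, posR]
    refine congrArg (fun z : ℤ => rename Sum.inr (esymmInt (Fin m) ℤ z)) ?_
    omega
  have hs : (∏ a : Fin K, (-1 : MvPolynomial (Fin n ⊕ Fin m) ℤ) ^
      (K + (shuf K (partSet P K h) (Sum.inr a) : ℕ))) * (∏ b : Fin K, (-1) ^ (b : ℕ)) = (-1) ^ i := by
    rw [← Finset.prod_mul_distrib]
    have : ∀ a : Fin K, (-1 : MvPolynomial (Fin n ⊕ Fin m) ℤ) ^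
      (K + (shuf K (partSet P K h) (Sum.inr a) : ℕ)) * (-1) ^ (a : ℕ) = (-1) ^ (partSeq P a) := by
      intro a
      have := partSeq_le P a
      rw [shuf_partSet_inr, ← pow_add]
      simp only [posR]
      rw [show K + (K + (a : ℕ) - partSeq P a) + a = partSeq P a + 2 * (K + a - partSeq P a) by
        omega, pow_add, pow_mul]
      simp
    rw [Finset.prod_congr rfl fun a _ => this a, Finset.prod_pow_eq_pow_sum,
      Fin.sum_univ_eq_sum_range (fun a => partSeq P a), partSeq_sum P K h]
  rw [wt, hX, hY, sign_partSet, ← mul_assoc (∏ a : Fin K, _), hs]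
  have h2 : ((-1 : MvPolynomial (Fin n ⊕ Fin m) ℤ) ^ i) * (-1) ^ i = 1 := by
    rw [← mul_pow]; simp
  push_cast
  linear_combination (rename Sum.inl (schurAux (Fin n) ℤ (conjSeq P) K) *
      rename Sum.inr (schurAux (Fin m) ℤ (partSeq P) K)) * h2

theorem posL_sum {i : ℕ} (P : Nat.Partition i) (K : ℕ) (h : i ≤ K) :
    ∑ a : Fin K, (posL P K h a : ℕ) = i + ∑ a : Fin K, (a : ℕ) := by
  simp only [posL]
  rw [Finset.sum_add_distrib, sum_rev, conjSeq_sum P K h]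

theorem partSet_inj {i : ℕ} (P Q : Nat.Partition i) (K : ℕ) (h : i ≤ K)
    (he : partSet P K h = partSet Q K h) : P = Q := by
  apply conjSeq_injective
  intro a
  by_cases ha : a < K
  · have h1 := shuf_partSet_inl P K h ⟨K - 1 - a, by omega⟩
    rw [he, shuf_partSet_inl] at h1
    simp only [posL, Fin.mk.injEq] at h1
    rw [show K - 1 - (K - 1 - a) = a by omega] at h1
    omega
  · rw [conjSeq_zero P a (by omega), conjSeq_zero Q a (by omega)]

theorem strictMono_gap {K N : ℕ} (s : Fin K → Fin N) (hs : StrictMono s) (a b : ℕ) (hb : b < K)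
    (hab : a ≤ b) : (s ⟨a, by omega⟩ : ℕ) + (b - a) ≤ s ⟨b, hb⟩ := by
  induction b, hab using Nat.le_induction with
  | base => simp
  | succ b hab ih =>
    have h1 := ih (by omega)
    have h2 : (s ⟨b, by omega⟩ : ℕ) < s ⟨b + 1, hb⟩ := hs (by simp)
    omega

theorem partSet_surj (i K : ℕ) (h : i ≤ K) (S : {S : Finset (Fin (K + K)) // #S = K})
    (hS : ∑ a : Fin K, (shuf K S (Sum.inl a) : ℕ) = i + ∑ a : Fin K, (a : ℕ)) :
    ∃ P : Nat.Partition i, partSet P K h = S := by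
  have hm := shuf_inl_mono K S
  let f : ℕ → ℕ := fun a => if ha : a < K then
    (shuf K S (Sum.inl ⟨K - 1 - a, by omega⟩) : ℕ) - (K - 1 - a) else 0
  have hge : ∀ (a : ℕ) (ha : a < K), a ≤ (shuf K S (Sum.inl ⟨a, ha⟩) : ℕ) := by
    intro a ha
    have := strictMono_gap _ hm 0 a ha (by omega)
    omega
  have hval : ∀ a : Fin K, f (K - 1 - a) + a = (shuf K S (Sum.inl a) : ℕ) := by
    intro a
    have h1 := hge a a.2
    have h2 : (⟨K - 1 - (K - 1 - a), by omega⟩ : Fin K) = a := by ext; simp; omega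
    simp only [f]
    rw [dif_pos (by omega), h2]
    simp only [Fin.eta] at h1
    omega
  have hf : Antitone f := by
    intro a b hab
    simp only [f]
    by_cases hb : b < K
    · rw [dif_pos hb, dif_pos (by omega)]
      have := strictMono_gap _ hm (K - 1 - b) (K - 1 - a) (by omega) (by omega)
      omega
    · rw [dif_neg hb]; omega
  have h0 : ∀ a, K ≤ a → f a = 0 := by
    intro a ha
    simp only [f]
    rw [dif_neg (by omega)]
  have hsum : ∑ a ∈ range K, f a = i := by
    have h1 : ∑ a : Fin K, (f (K - 1 - a) + a) = i + ∑ a : Fin K, (a : ℕ) := by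
      rw [← hS]
      exact Finset.sum_congr rfl fun a _ => hval a
    rw [Finset.sum_add_distrib, sum_rev] at h1
    omega
  obtain ⟨P, hP⟩ := conjSeq_surj i K f hf h0 hsum
  refine ⟨P, Subtype.ext ?_⟩
  rw [← shuf_image K S]
  simp only [partSet]
  congr 1
  ext a
  simp only [posL, hP, hval]

/-- Cauchy identity for Schur polynomials.  For each `i ≥ 1`, the `i`-th
elementary symmetric function of the products `(x_a y_b)` equals
`∑_{|λ| = i} s_λ(x) · s_{λ'}(y)`, where the sum runs over partitions `λ` of `i` and `λ'`
denotes the conjugate partition. -/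
theorem stmt12 (i : ℕ) (hi : 1 ≤ i) (n m : ℕ) :
    (∑ s ∈ (univ : Finset (Fin n × Fin m)).powersetCard i,
        ∏ p ∈ s, (X (Sum.inl p.1) * X (Sum.inr p.2) : MvPolynomial (Fin n ⊕ Fin m) ℤ))
      = ∑ P : Nat.Partition i,
          rename Sum.inl (schurAux (Fin n) ℤ (conjSeq P) i) *
          rename Sum.inr (schurAux (Fin m) ℤ (partSeq P) i) := by
  have hn : n ≤ i + (n + m) := by omega
  have hm : m ≤ i + (n + m) := by omega
  have hK : i ≤ i + (n + m) := by omega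
  rw [lhs_eq i n m (i + (n + m)) hn hm]
  symm
  refine Finset.sum_bij (fun P _ => partSet P (i + (n + m)) hK) ?_ ?_ ?_ ?_
  · intro P _
    simp only [mem_filter, mem_univ, true_and, shuf_partSet_inl]
    exact posL_sum P _ hK
  · intro P _ Q _ h
    exact partSet_inj P Q _ hK h
  · intro S hS
    obtain ⟨P, hP⟩ := partSet_surj i _ hK S (mem_filter.1 hS).2
    exact ⟨P, mem_univ _, hP⟩
  · intro P _
    rw [wt_partSet, schurAux_add _ _ _ _ (conjSeq_zero P), schurAux_add _ _ _ _ (partSeq_zero P)]
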